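/- arXiv:1711.04537 — 2 statements merged into one kernel-verified Lean document; each statement's English description precedes it below -/
import Mathlib

section
/- For all integers n ≥ 1 and r ≥ 0, 1 + Σ_{k=1}^{n} (-1)^k · D_{k+r+3}(r) / ((k+2) · C(k+r+3, r)) = (-1)^n · D_{n+r+2}(r) / C(n+r+2, r), where the identity is taken in the rational numbers and C(m,r) denotes the binomial coefficient. -/
/-- `D n` is the number of derangements of an `n`-element set, i.e. the number of
permutations of `{1,...,n}` with no fixed point. -/
def D (n : ℕ) : ℕ := Fintype.card (derangements (Fin n))

/-- The rencontres number `R n r` is the number of permutations of `{1,...,n}`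
having exactly `r` fixed points. -/
def R (n r : ℕ) : ℕ :=
  (Finset.univ.filter fun σ : Equiv.Perm (Fin n) =>
    (Finset.univ.filter fun x : Fin n => σ x = x).card = r).card

lemma card_fiber_fixed {n : ℕ} (s : Finset (Fin n)) :
    (Finset.univ.filter fun σ : Equiv.Perm (Fin n) =>
      (Finset.univ.filter fun x : Fin n => σ x = x) = s).card
      = numDerangements (n - s.card) := by
  classical
  have h1 : Fintype.card {x : Fin n // x ∉ s} = n - s.card := by
    simp
  rw [← h1, ← card_derangements_eq_numDerangements,
    Fintype.card_congr (derangements.subtypeEquiv (fun x : Fin n => x ∉ s)),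
    Fintype.card_subtype]
  congr 1
  ext σ
  simp only [Finset.mem_filter, Finset.mem_univ, true_and, Finset.ext_iff, not_not,
    Function.mem_fixedPoints, Function.IsFixedPt]
  exact forall_congr' fun a => Iff.comm

lemma R_eq (m r : ℕ) : R (m + r) r = (m + r).choose r * numDerangements m := by
  classical
  unfold R
  rw [Finset.card_eq_sum_card_fiberwise
    (f := fun σ : Equiv.Perm (Fin (m + r)) => Finset.univ.filter fun x => σ x = x)
    (t := Finset.powersetCard r Finset.univ)]
  · have : ∀ s ∈ Finset.powersetCard r (Finset.univ : Finset (Fin (m + r))),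
        ((Finset.univ.filter fun σ : Equiv.Perm (Fin (m + r)) =>
          (Finset.univ.filter fun x => σ x = x).card = r).filter fun σ =>
            (Finset.univ.filter fun x => σ x = x) = s).card = numDerangements m := by
      intro s hs
      rw [Finset.mem_powersetCard] at hs
      have h := card_fiber_fixed s
      rw [hs.2, Nat.add_sub_cancel] at h
      rw [← h, Finset.filter_filter]
      congr 1
      ext σ
      simp only [Finset.mem_filter, Finset.mem_univ, true_and]
      exact ⟨fun h => h.2, fun h => ⟨by rw [h]; exact hs.2, h⟩⟩
    rw [Finset.sum_congr rfl this]
    simp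
  · intro σ hσ
    simpa using hσ

lemma R_div (m r : ℕ) : (R (m + r) r : ℚ) = (m + r).choose r * numDerangements m := by
  exact_mod_cast R_eq m r

lemma aux_sum (n r : ℕ) :
    1 + ∑ k ∈ Finset.Icc 1 n, (-1 : ℚ) ^ k * (R (k + r + 3) r : ℚ)
        / ((k + 2) * (k + r + 3).choose r)
      = (-1 : ℚ) ^ n * (R (n + r + 2) r : ℚ) / (n + r + 2).choose r := by
  have hc : ∀ m : ℕ, (((m + r).choose r : ℕ) : ℚ) ≠ 0 := fun m => by
    exact_mod_cast (Nat.choose_pos (Nat.le_add_left r m)).ne'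
  have hb : ∀ n : ℕ, (-1 : ℚ) ^ n * (R (n + r + 2) r : ℚ) / (n + r + 2).choose r
      = (-1) ^ n * numDerangements (n + 2) := fun n => by
    rw [show n + r + 2 = (n + 2) + r by omega, R_div]
    field_simp [hc (n + 2)]
  rw [hb]
  induction n with
  | zero => simp [numDerangements_add_two]
  | succ n ih =>
    rw [Finset.sum_Icc_succ_top (by omega), ← add_assoc, ih,
      show n + 1 + r + 3 = (n + 1 + 3) + r by omega, R_div]
    have h := hc (n + 1 + 3)
    have h2 : (((n + 1 : ℕ) : ℚ) + 2) ≠ 0 := by positivity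
    have h3 : (numDerangements (n + 1 + 3) : ℚ) =
        (((n + 1 : ℕ) : ℚ) + 2) * (numDerangements (n + 2) + numDerangements (n + 1 + 2)) := by
      rw [show n + 1 + 3 = (n + 2) + 2 by omega, numDerangements_add_two]
      push_cast
      ring
    have h4 : ∀ a c k x y : ℚ, c ≠ 0 → k ≠ 0 → a * (c * (k * (x + y))) / (k * c) = a * (x + y) := by
      intro a c k x y hc hk
      field_simp
    rw [h3, h4 _ _ _ _ _ h h2]
    ring

theorem rencontres_alternating_sum (n r : ℕ) (hn : 1 ≤ n) :
    1 + ∑ k ∈ Finset.Icc 1 n, (-1 : ℚ) ^ k * (R (k + r + 3) r : ℚ)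
        / ((k + 2) * (k + r + 3).choose r)
      = (-1 : ℚ) ^ n * (R (n + r + 2) r : ℚ) / (n + r + 2).choose r := by
  exact aux_sum n r
end

section
/- For all integers n ≥ 1 and r ≥ 0 and every k with 1 ≤ k ≤ n, the rational number D_{k+r+3}(r) / ((k+2) · C(k+r+3, r)) is an integer; equivalently, (k+2) · C(k+r+3, r) divides D_{k+r+3}(r). -/
lemma R_fiber (n : ℕ) (s : Finset (Fin n)) :
    (Finset.univ.filter fun σ : Equiv.Perm (Fin n) =>
      (Finset.univ.filter fun x : Fin n => σ x = x) = s).card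
      = numDerangements (n - s.card) := by
  have h1 : Fintype.card {x : Fin n // x ∉ s} = n - s.card := by
    rw [Fintype.card_subtype_compl]
    simp
  rw [← h1, ← card_derangements_eq_numDerangements,
    Fintype.card_congr (derangements.subtypeEquiv (fun x : Fin n => x ∉ s)),
    Fintype.card_subtype]
  congr 1
  ext σ
  simp only [Finset.mem_filter, Finset.mem_univ, true_and, Finset.ext_iff, not_not,
    Function.mem_fixedPoints, Function.IsFixedPt]
  exact forall_congr' fun a => Iff.comm

lemma R_eq_s13 (n r : ℕ) : R n r = n.choose r * numDerangements (n - r) := by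
  unfold R
  rw [Finset.card_eq_sum_card_fiberwise
    (f := fun σ : Equiv.Perm (Fin n) => Finset.univ.filter fun x : Fin n => σ x = x)
    (t := Finset.powersetCard r Finset.univ)]
  · rw [Finset.sum_congr rfl (g := fun _ => numDerangements (n - r))]
    · simp
    · intro s hs
      have hs' := (Finset.mem_powersetCard.1 hs).2
      rw [← hs', ← R_fiber, Finset.filter_filter]
      congr 1
      ext σ
      simp only [Finset.mem_filter, Finset.mem_univ, true_and]
      exact ⟨fun h => h.2, fun h => ⟨by rw [h], h⟩⟩
  · intro σ hσ
    simpa [Finset.mem_powersetCard] using hσ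

theorem rencontres_term_integrality (n r : ℕ) (hn : 1 ≤ n) (k : ℕ) (hk1 : 1 ≤ k)
    (hk2 : k ≤ n) : ((k + 2) * (k + r + 3).choose r) ∣ R (k + r + 3) r := by
  rw [R_eq_s13, show k + r + 3 - r = (k + 1) + 2 by omega, numDerangements_add_two, mul_comm (k + 2)]
  exact mul_dvd_mul_left _ (Dvd.intro _ rfl)
end
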